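/- For every real β > 0 there exists a constant A_β ∈ ℝ such that, as n → ∞, Σ_{k=1}^n log Γ(βk/2) = (βn²/4)·log(βn/2) − 3βn²/8 + ((β−2)n/4)·log(βn/2) + (n/4)·log(4π²·e^{2−β}) + ((β²−6β+4)/(24β))·log(βn/2) + A_β + O(1/n); that is, there are C > 0 and N ∈ ℕ such that for all n ≥ N the absolute difference between Σ_{k=1}^n log Γ(βk/2) and the displayed sum of terms (without the O(1/n) term) is at most C/n. -/

import Mathlib

open Filter Topology

/-- Third order Taylor bound for the logarithm. -/
lemma slg_log_bound (v : ℝ) (hv : |v| ≤ 1 / 2) :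
    |Real.log (1 - v) + (v + v ^ 2 / 2 + v ^ 3 / 3)| ≤ 2 * v ^ 4 := by
  have h := Real.abs_log_sub_add_sum_range_le (x := v) (by linarith) 3
  have e : (∑ i ∈ Finset.range 3, v ^ (i + 1) / ((i : ℝ) + 1)) = v + v ^ 2 / 2 + v ^ 3 / 3 := by
    simp [Finset.sum_range_succ]; norm_num
  rw [e, add_comm] at h
  refine h.trans ?_
  have h4 : |v| ^ (3 + 1) = v ^ 4 := Even.pow_abs (by decide) v
  rw [h4, div_le_iff₀ (by linarith)]
  have : 0 ≤ v ^ 4 := by positivity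
  nlinarith

/-- Remainder in Stirling's formula for `log Γ`. -/
noncomputable def slgMu (x : ℝ) : ℝ :=
  Real.log (Real.Gamma x) -
    ((x - 1 / 2) * Real.log x - x + Real.log (2 * Real.pi) / 2 + 1 / (12 * x))

lemma slg_mu_step (x : ℝ) (hx : 2 ≤ x) :
    |slgMu (x + 1) - slgMu x| ≤ 3 * (1 / x ^ 2 - 1 / (x + 1) ^ 2) := by
  have hx0 : 0 < x := by linarith
  have hu : |(-(1 / x))| ≤ 1 / 2 := by
    rw [abs_neg, abs_of_pos (by positivity)]
    exact one_div_le_one_div_of_le (by norm_num) hx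
  have hb := slg_log_bound _ hu
  set r := Real.log (1 - -(1 / x)) + (-(1 / x) + (-(1 / x)) ^ 2 / 2 + (-(1 / x)) ^ 3 / 3) with hr
  have hlog : Real.log (x + 1) = Real.log x + Real.log (1 - -(1 / x)) := by
    rw [← Real.log_mul (by positivity) (by rw [sub_neg_eq_add]; positivity)]
    congr 1; field_simp; ring
  have hG : Real.log (Real.Gamma (x + 1)) = Real.log x + Real.log (Real.Gamma x) := by
    rw [Real.Gamma_add_one hx0.ne', Real.log_mul hx0.ne' (Real.Gamma_pos_of_pos hx0).ne']
  have hl : Real.log (1 - -(1 / x)) =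
      r - (-(1 / x) + (-(1 / x)) ^ 2 / 2 + (-(1 / x)) ^ 3 / 3) := by rw [hr]; ring
  have key : slgMu (x + 1) - slgMu x =
      -(1 / (6 * x ^ 3) + 1 / (12 * x ^ 2 * (x + 1))) - (x + 1 / 2) * r := by
    unfold slgMu
    rw [hG, hlog, hl]
    field_simp
    ring
  have h1 : |(x + 1 / 2) * r| ≤ (x + 1 / 2) * (2 * (-(1 / x)) ^ 4) := by
    rw [abs_mul, abs_of_pos (by positivity : 0 < x + 1 / 2)]
    gcongr
  have h2 : |1 / (6 * x ^ 3) + 1 / (12 * x ^ 2 * (x + 1))|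
      = 1 / (6 * x ^ 3) + 1 / (12 * x ^ 2 * (x + 1)) := abs_of_pos (by positivity)
  have h3 : 1 / (6 * x ^ 3) + 1 / (12 * x ^ 2 * (x + 1)) + (x + 1 / 2) * (2 * (-(1 / x)) ^ 4)
      ≤ 3 * (1 / x ^ 3) := by
    have a1 : 1 / (12 * x ^ 2 * (x + 1)) ≤ 1 / (12 * x ^ 3) :=
      one_div_le_one_div_of_le (by positivity) (by nlinarith [sq_nonneg x])
    have a2 : 3 * (1 / x ^ 3) - (1 / (6 * x ^ 3) + 1 / (12 * x ^ 3)
        + (x + 1 / 2) * (2 * (-(1 / x)) ^ 4)) = (3 / 4 * x - 1) / x ^ 4 := by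
      field_simp; ring
    have a3 : 0 ≤ (3 / 4 * x - 1) / x ^ 4 := div_nonneg (by linarith) (by positivity)
    linarith
  have h4 : 1 / x ^ 3 ≤ 1 / x ^ 2 - 1 / (x + 1) ^ 2 := by
    have : 1 / x ^ 2 - 1 / (x + 1) ^ 2 - 1 / x ^ 3 = (x ^ 2 - x - 1) / (x ^ 3 * (x + 1) ^ 2) := by
      field_simp; ring
    have h5 : 0 ≤ (x ^ 2 - x - 1) / (x ^ 3 * (x + 1) ^ 2) :=
      div_nonneg (by nlinarith) (by positivity)
    linarith
  rw [key]
  calc _ ≤ |(-(1 / (6 * x ^ 3) + 1 / (12 * x ^ 2 * (x + 1))))| + |(x + 1 / 2) * r| := abs_sub _ _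
    _ ≤ 3 * (1 / x ^ 3) := by rw [abs_neg, h2]; linarith
    _ ≤ _ := by linarith

lemma slg_mu_tendsto (x : ℝ) (hx : 0 < x) :
    Tendsto (fun n : ℕ => slgMu (x + (n + 1 : ℕ))) atTop (𝓝 0) := by
  have t1 : Tendsto (fun n : ℕ => Real.log (Real.Gamma x) - Real.BohrMollerup.logGammaSeq x n)
      atTop (𝓝 0) := by
    simpa using (tendsto_const_nhds (x := Real.log (Real.Gamma x))).sub
      (Real.BohrMollerup.tendsto_log_gamma hx)
  have t2 : Tendsto (fun n : ℕ => Real.log (Stirling.stirlingSeq n) - Real.log (√Real.pi))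
      atTop (𝓝 0) := by
    have h := (Stirling.tendsto_stirlingSeq_sqrt_pi.log
      (by positivity)).sub_const (Real.log (√Real.pi))
    simpa using h
  have t3 : Tendsto (fun n : ℕ => (n : ℝ) * Real.log (1 + (x + 1) / n)) atTop (𝓝 (x + 1)) := by
    have h : Tendsto (fun y : ℝ => y * ((x + 1) / y)) atTop (𝓝 (x + 1)) := by
      refine tendsto_const_nhds.congr' ?_
      filter_upwards [eventually_gt_atTop 0] with y hy
      field_simp
    exact (Real.tendsto_mul_log_one_add_of_tendsto h).comp tendsto_natCast_atTop_atTop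
  have t4 : Tendsto (fun n : ℕ => Real.log (1 + (x + 1) / n)) atTop (𝓝 0) := by
    have h : Tendsto (fun n : ℕ => 1 + (x + 1) / (n : ℝ)) atTop (𝓝 (1 + 0)) :=
      (tendsto_const_div_atTop_nhds_zero_nat (x + 1)).const_add 1
    have h' := h.log (by norm_num)
    simpa using h'
  have t5 : Tendsto (fun n : ℕ => 1 / (12 * (x + (n + 1 : ℕ)))) atTop (𝓝 (0 : ℝ)) := by
    have h : Tendsto (fun n : ℕ => 12 * (x + ((n + 1 : ℕ) : ℝ))) atTop atTop := by
      refine Tendsto.const_mul_atTop (by norm_num) (tendsto_atTop_add_const_left _ _ ?_)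
      exact tendsto_natCast_atTop_atTop.comp (tendsto_add_atTop_nat 1)
    exact h.inv_tendsto_atTop.congr (fun n => (one_div _).symm)
  have T := (((t1.add t2).sub (t3.sub_const (x + 1))).sub (t4.const_mul (x + 1 / 2))).sub t5
  have e0 : (0 : ℝ) + 0 - (x + 1 - (x + 1)) - (x + 1 / 2) * 0 - 0 = 0 := by ring
  rw [e0] at T
  refine T.congr' ?_
  filter_upwards [eventually_ge_atTop 1] with n hn
  have hn0 : (0 : ℝ) < n := by exact_mod_cast hn
  have hG : Real.log (Real.Gamma (x + (n + 1 : ℕ))) = Real.log (Real.Gamma x)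
      + ∑ m ∈ Finset.range (n + 1), Real.log (x + m) := by
    refine Real.BohrMollerup.f_add_nat_eq (f := fun y => Real.log (Real.Gamma y)) ?_ hx (n + 1)
    intro y hy
    change Real.log (Real.Gamma (y + 1)) = _
    rw [Real.Gamma_add_one hy.ne', Real.log_mul hy.ne' (Real.Gamma_pos_of_pos hy).ne', add_comm]
  have hS := Stirling.log_stirlingSeq_formula n
  have e1 : Real.log (2 * (n : ℝ)) = Real.log 2 + Real.log n :=
    Real.log_mul (by norm_num) hn0.ne'
  have e2 : Real.log ((n : ℝ) / Real.exp 1) = Real.log n - 1 := by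
    rw [Real.log_div hn0.ne' (Real.exp_pos 1).ne', Real.log_exp]
  have e3 : Real.log (√Real.pi) = Real.log Real.pi / 2 := Real.log_sqrt Real.pi_pos.le
  have e4 : Real.log (2 * Real.pi) = Real.log 2 + Real.log Real.pi :=
    Real.log_mul (by norm_num) Real.pi_pos.ne'
  have e5 : Real.log (x + (n + 1 : ℕ)) = Real.log n + Real.log (1 + (x + 1) / n) := by
    rw [← Real.log_mul hn0.ne' (by positivity)]
    congr 1; push_cast; field_simp; ring
  rw [hS, e1, e2, e3]
  unfold slgMu Real.BohrMollerup.logGammaSeq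
  rw [hG, e4, e5]
  push_cast
  ring

lemma slg_mu_bound (x : ℝ) (hx : 2 ≤ x) : |slgMu x| ≤ 3 / x ^ 2 := by
  have tele : ∀ n : ℕ, |slgMu (x + n) - slgMu x| ≤ 3 * (1 / x ^ 2 - 1 / (x + n) ^ 2) := by
    intro n
    induction n with
    | zero => simp
    | succ n ih =>
      have hn : (0 : ℝ) ≤ n := Nat.cast_nonneg n
      have h := slg_mu_step (x + n) (by linarith)
      have := abs_add_le (slgMu (x + n + 1) - slgMu (x + n)) (slgMu (x + n) - slgMu x)
      rw [sub_add_sub_cancel] at this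
      push_cast
      rw [← add_assoc]
      linarith
  have hle : ∀ n : ℕ, |slgMu (x + (n + 1 : ℕ)) - slgMu x| ≤ 3 / x ^ 2 := by
    intro n
    refine (tele (n + 1)).trans ?_
    have : 0 ≤ 1 / (x + ((n + 1 : ℕ) : ℝ)) ^ 2 := by positivity
    have e : 3 / x ^ 2 = 3 * (1 / x ^ 2) := by ring
    rw [e]
    linarith
  have T := ((slg_mu_tendsto x (by linarith)).sub_const (slgMu x)).abs
  have := le_of_tendsto' T hle
  simpa using this

/-- A sequence with increments of size `O(1/n²)` converges with rate `O(1/n)`. -/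
lemma slg_converge (D : ℕ → ℝ) (K : ℝ) (N : ℕ) (hN : 1 ≤ N)
    (h : ∀ n : ℕ, N ≤ n → |D (n + 1) - D n| ≤ K * (1 / (n : ℝ) - 1 / ((n : ℝ) + 1)))
    (hK : 0 ≤ K) :
    ∃ A : ℝ, ∀ n : ℕ, N ≤ n → |D n - A| ≤ K / n := by
  have tele : ∀ n : ℕ, N ≤ n → ∀ j : ℕ,
      |D (n + j) - D n| ≤ K * (1 / (n : ℝ) - 1 / ((n : ℝ) + j)) := by
    intro n hn j
    induction j with
    | zero => simp
    | succ j ih =>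
      have h1 := h (n + j) (by omega)
      have := abs_add_le (D (n + j + 1) - D (n + j)) (D (n + j) - D n)
      rw [sub_add_sub_cancel] at this
      push_cast at h1 ⊢
      rw [← add_assoc, ← add_assoc]
      linarith
  have hle : ∀ n : ℕ, N ≤ n → ∀ m : ℕ, n ≤ m → |D m - D n| ≤ K / n := by
    intro n hn m hm
    obtain ⟨j, rfl⟩ := Nat.exists_eq_add_of_le hm
    refine (tele n hn j).trans ?_
    have : 0 ≤ K * (1 / ((n : ℝ) + j)) := by positivity
    have e : K / (n : ℝ) = K * (1 / n) := by ring
    rw [e]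
    linarith
  have hc : CauchySeq D := by
    rw [Metric.cauchySeq_iff']
    intro ε hε
    have t : Tendsto (fun n : ℕ => K / (n : ℝ)) atTop (𝓝 0) :=
      tendsto_const_div_atTop_nhds_zero_nat K
    obtain ⟨M, hM1, hM2⟩ := ((t.eventually (gt_mem_nhds hε)).and (eventually_ge_atTop N)).exists
    refine ⟨M, fun n hn => ?_⟩
    rw [Real.dist_eq]
    exact (hle M hM2 n hn).trans_lt hM1
  obtain ⟨A, hA⟩ := cauchySeq_tendsto_of_complete hc
  refine ⟨A, fun n hn => ?_⟩
  rw [abs_sub_comm]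
  refine le_of_tendsto (hA.sub_const (D n)).abs ?_
  filter_upwards [eventually_ge_atTop n] with m hm
  exact hle n hn m hm

/-- The main term, as a function of a real variable. -/
noncomputable def slgF (β t : ℝ) : ℝ :=
  β * t ^ 2 / 4 * Real.log (β * t / 2)
    - 3 * β * t ^ 2 / 8
    + (β - 2) * t / 4 * Real.log (β * t / 2)
    + t / 4 * Real.log (4 * Real.pi ^ 2 * Real.exp (2 - β))
    + (β ^ 2 - 6 * β + 4) / (24 * β) * Real.log (β * t / 2)

set_option maxHeartbeats 1000000 in
lemma slg_F_step (β : ℝ) (hβ : 0 < β) : ∃ K : ℝ, 0 ≤ K ∧ ∀ m : ℝ, 2 ≤ m →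
    |((β * m / 2 - 1 / 2) * Real.log (β * m / 2) - β * m / 2 + Real.log (2 * Real.pi) / 2
      + 1 / (12 * (β * m / 2))) - (slgF β m - slgF β (m - 1))| ≤ K / m ^ 2 := by
  obtain ⟨c, hc⟩ : ∃ c, c = (β ^ 2 - 6 * β + 4) / (24 * β) := ⟨_, rfl⟩
  refine ⟨|(β / 4 + 1 / 2) / 3 - (1 / 2 + c) / 2| + |(1 / 2 + c) / 3|
    + 2 * (β / 4 + (β / 4 + 1 / 2) + |1 / 2 + c|), by positivity, ?_⟩
  intro m hm
  have hm0 : 0 < m := by linarith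
  have hu : |1 / m| ≤ 1 / 2 := by
    rw [abs_of_pos (by positivity)]
    exact one_div_le_one_div_of_le (by norm_num) hm
  have hb := slg_log_bound _ hu
  set r := Real.log (1 - 1 / m) + (1 / m + (1 / m) ^ 2 / 2 + (1 / m) ^ 3 / 3) with hr
  have hl : Real.log (1 - 1 / m) = r - (1 / m + (1 / m) ^ 2 / 2 + (1 / m) ^ 3 / 3) := by
    rw [hr]; ring
  have h1m : 0 < 1 - 1 / m := by
    have := (le_abs_self (1 / m)).trans hu
    linarith
  have hlog : Real.log (β * (m - 1) / 2) = Real.log (β * m / 2) + Real.log (1 - 1 / m) := by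
    rw [← Real.log_mul (by positivity) h1m.ne']
    congr 1; field_simp
  have hpi : Real.log (4 * Real.pi ^ 2 * Real.exp (2 - β))
      = 2 * Real.log (2 * Real.pi) + (2 - β) := by
    rw [Real.log_mul (by positivity) (Real.exp_pos _).ne', Real.log_exp,
      show 4 * Real.pi ^ 2 = (2 * Real.pi) ^ 2 by ring, Real.log_pow]
    norm_num
  have hcβ : 1 / (12 * (β * m / 2)) = (c - β / 24 + 1 / 4) / m := by
    rw [hc]; field_simp; ring
  have key : ((β * m / 2 - 1 / 2) * Real.log (β * m / 2) - β * m / 2 + Real.log (2 * Real.pi) / 2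
      + 1 / (12 * (β * m / 2))) - (slgF β m - slgF β (m - 1)) =
      ((β / 4 + 1 / 2) / 3 - (1 / 2 + c) / 2) * (1 / m ^ 2) - (1 / 2 + c) / 3 * (1 / m ^ 3)
      + (β / 4 * m ^ 2 - (β / 4 + 1 / 2) * m + (1 / 2 + c)) * r := by
    rw [hcβ]
    unfold slgF
    rw [hlog, hpi, hl, ← hc]
    field_simp
    ring
  have b3 : 1 / m ^ 3 ≤ 1 / m ^ 2 :=
    one_div_le_one_div_of_le (by positivity) (pow_le_pow_right₀ (by linarith) (by norm_num))
  have q : |β / 4 * m ^ 2 - (β / 4 + 1 / 2) * m + (1 / 2 + c)|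
      ≤ (β / 4 + (β / 4 + 1 / 2) + |1 / 2 + c|) * m ^ 2 := by
    have s1 : m ≤ m ^ 2 := by nlinarith
    have s2 : 1 ≤ m ^ 2 := by nlinarith
    have s3 := mul_le_mul_of_nonneg_left s1 (by positivity : 0 ≤ β / 4 + 1 / 2)
    have s4 := mul_le_mul_of_nonneg_left s2 (abs_nonneg (1 / 2 + c))
    have s5 : 0 ≤ β / 4 * m ^ 2 := by positivity
    have s6 : 0 ≤ (β / 4 + 1 / 2) * m := by positivity
    rw [abs_le]
    constructor <;> linarith [neg_abs_le (1 / 2 + c), le_abs_self (1 / 2 + c)]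
  have p3 : |(β / 4 * m ^ 2 - (β / 4 + 1 / 2) * m + (1 / 2 + c)) * r|
      ≤ 2 * (β / 4 + (β / 4 + 1 / 2) + |1 / 2 + c|) * (1 / m ^ 2) := by
    rw [abs_mul]
    calc _ ≤ ((β / 4 + (β / 4 + 1 / 2) + |1 / 2 + c|) * m ^ 2) * (2 * (1 / m) ^ 4) := by gcongr
      _ = _ := by field_simp
  have p1 : |((β / 4 + 1 / 2) / 3 - (1 / 2 + c) / 2) * (1 / m ^ 2)|
      = |(β / 4 + 1 / 2) / 3 - (1 / 2 + c) / 2| * (1 / m ^ 2) := by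
    rw [abs_mul, abs_of_pos (by positivity : 0 < 1 / m ^ 2)]
  have p2 : |(1 / 2 + c) / 3 * (1 / m ^ 3)| ≤ |(1 / 2 + c) / 3| * (1 / m ^ 2) := by
    rw [abs_mul, abs_of_pos (by positivity : 0 < 1 / m ^ 3)]
    gcongr
  rw [key]
  refine (abs_add_le _ _).trans ?_
  have := abs_sub (((β / 4 + 1 / 2) / 3 - (1 / 2 + c) / 2) * (1 / m ^ 2))
    ((1 / 2 + c) / 3 * (1 / m ^ 3))
  rw [p1] at this
  refine (add_le_add (this.trans (add_le_add le_rfl p2)) p3).trans (le_of_eq ?_)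
  rw [← add_mul, ← add_mul, mul_one_div]


/-- **Asymptotics of the product of Gamma values** (Lemma 2.2).
For every real `β > 0` there is a constant `A_β ∈ ℝ` such that
`∑_{k=1}^n log Γ(βk/2) = (βn²/4)·log(βn/2) − 3βn²/8 + ((β−2)n/4)·log(βn/2)
  + (n/4)·log(4π²e^{2−β}) + ((β²−6β+4)/(24β))·log(βn/2) + A_β + O(1/n)`. -/
theorem sum_log_gamma_asymptotics (β : ℝ) (hβ : 0 < β) :
    ∃ A : ℝ, ∃ C : ℝ, 0 < C ∧ ∃ N : ℕ, ∀ n : ℕ, N ≤ n →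
      |(∑ k ∈ Finset.Icc 1 n, Real.log (Real.Gamma (β * k / 2))) -
          (β * (n : ℝ) ^ 2 / 4 * Real.log (β * n / 2)
            - 3 * β * (n : ℝ) ^ 2 / 8
            + (β - 2) * (n : ℝ) / 4 * Real.log (β * n / 2)
            + (n : ℝ) / 4 * Real.log (4 * Real.pi ^ 2 * Real.exp (2 - β))
            + (β ^ 2 - 6 * β + 4) / (24 * β) * Real.log (β * n / 2)
            + A)| ≤ C / n := by
  obtain ⟨K, hK, hF⟩ := slg_F_step β hβ
  obtain ⟨N0, hN0⟩ := exists_nat_ge (4 / β)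
  have hstep : ∀ n : ℕ, N0 + 1 ≤ n →
      |((∑ k ∈ Finset.Icc 1 (n + 1), Real.log (Real.Gamma (β * k / 2))) - slgF β (n + 1 : ℕ)) -
        ((∑ k ∈ Finset.Icc 1 n, Real.log (Real.Gamma (β * k / 2))) - slgF β n)|
      ≤ (12 / β ^ 2 + K) * (1 / (n : ℝ) - 1 / ((n : ℝ) + 1)) := by
    intro n hn
    have hn1 : (N0 : ℝ) + 1 ≤ n := by exact_mod_cast hn
    have hN0' : (0 : ℝ) ≤ N0 := Nat.cast_nonneg _
    have hn0 : (0 : ℝ) < n := by linarith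
    have hm := hF ((n : ℝ) + 1) (by linarith)
    have hx : 2 ≤ β * ((n : ℝ) + 1) / 2 := by
      have : 4 / β ≤ (n : ℝ) + 1 := by linarith
      rw [div_le_iff₀ hβ] at this
      linarith
    have hmu := slg_mu_bound _ hx
    rw [add_sub_cancel_right] at hm
    rw [Finset.sum_Icc_succ_top (by omega)]
    push_cast
    have e : ((∑ k ∈ Finset.Icc 1 n, Real.log (Real.Gamma (β * k / 2)))
        + Real.log (Real.Gamma (β * ((n : ℝ) + 1) / 2)) - slgF β ((n : ℝ) + 1)) -
        ((∑ k ∈ Finset.Icc 1 n, Real.log (Real.Gamma (β * k / 2))) - slgF β n)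
        = slgMu (β * ((n : ℝ) + 1) / 2) +
        (((β * ((n : ℝ) + 1) / 2 - 1 / 2) * Real.log (β * ((n : ℝ) + 1) / 2)
          - β * ((n : ℝ) + 1) / 2 + Real.log (2 * Real.pi) / 2
          + 1 / (12 * (β * ((n : ℝ) + 1) / 2))) - (slgF β ((n : ℝ) + 1) - slgF β n)) := by
      unfold slgMu
      ring
    rw [e]
    have e2 : 3 / (β * ((n : ℝ) + 1) / 2) ^ 2 = 12 / β ^ 2 * (1 / ((n : ℝ) + 1) ^ 2) := by
      field_simp; norm_num
    have e3 : K / ((n : ℝ) + 1) ^ 2 = K * (1 / ((n : ℝ) + 1) ^ 2) := by ring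
    have e4 : 1 / ((n : ℝ) + 1) ^ 2 ≤ 1 / (n : ℝ) - 1 / ((n : ℝ) + 1) := by
      have : 1 / (n : ℝ) - 1 / ((n : ℝ) + 1) = 1 / (n * ((n : ℝ) + 1)) := by
        field_simp; ring
      rw [this]
      exact one_div_le_one_div_of_le (by positivity) (by nlinarith)
    have e5 := mul_le_mul_of_nonneg_left e4 (by positivity : 0 ≤ 12 / β ^ 2 + K)
    refine (abs_add_le _ _).trans ?_
    rw [e2] at hmu
    rw [e3] at hm
    linarith
  obtain ⟨A, hA⟩ := slg_converge
    (fun n => (∑ k ∈ Finset.Icc 1 n, Real.log (Real.Gamma (β * k / 2))) - slgF β n)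
    (12 / β ^ 2 + K) (N0 + 1) (by omega) hstep (by positivity)
  refine ⟨A, 12 / β ^ 2 + K, by positivity, N0 + 1, fun n hn => ?_⟩
  have h := hA n hn
  beta_reduce at h
  rw [sub_sub] at h
  exact h
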